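/- For every n with 3 ≤ n ≤ 10, the minimum size S₂(n) of a 2-CNF p-encoding with n input variables equals 3n − 6. -/

import Mathlib

/-- A literal is a variable together with a polarity (`true` = positive). -/
abbrev Lit (V : Type) := V × Bool

/-- The negation of a literal. -/
def negLit {V : Type} (l : Lit V) : Lit V := (l.1, !l.2)

/-- A clause is a finite set of literals. -/
abbrev Clause (V : Type) := Finset (Lit V)

/-- A CNF formula is a finite set of clauses. -/
abbrev CNF (V : Type) := Finset (Clause V)

/-- A clause proper contains no complementary pair of literals. -/
def IsClause {V : Type} [DecidableEq V] (C : Clause V) : Prop := ∀ l ∈ C, negLit l ∉ C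

instance {V : Type} [DecidableEq V] (C : Clause V) : Decidable (IsClause C) := by
  unfold IsClause; infer_instance

/-- A CNF formula proper consists of proper clauses. -/
def IsCNF {V : Type} [DecidableEq V] (φ : CNF V) : Prop := ∀ C ∈ φ, IsClause C

/-- Satisfaction of a literal by an assignment. -/
def LitSat {V : Type} (α : V → Bool) (l : Lit V) : Prop := α l.1 = l.2

/-- Satisfaction of a clause by an assignment. -/
def ClauseSat {V : Type} (α : V → Bool) (C : Clause V) : Prop := ∃ l ∈ C, LitSat α l

/-- Satisfaction of a CNF formula by an assignment. -/
def CnfSat {V : Type} (α : V → Bool) (φ : CNF V) : Prop := ∀ C ∈ φ, ClauseSat α C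

/-- `UnitDerives φ C` : the clause `C` can be derived from `φ` by a series of unit
resolutions (each step resolves a derived unit clause with another derived clause). -/
inductive UnitDerives {V : Type} [DecidableEq V] (φ : CNF V) : Clause V → Prop
  | base {C : Clause V} (h : C ∈ φ) : UnitDerives φ C
  | step {l : Lit V} {C : Clause V} (h1 : UnitDerives φ {l})
      (h2 : UnitDerives φ C) (h3 : negLit l ∈ C) :
      UnitDerives φ (C.erase (negLit l))

/-- The formula `φ ∧ l` (adding a unit clause). -/
def addUnit {V : Type} [DecidableEq V] (φ : CNF V) (l : Lit V) : CNF V :=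
  insert {l} φ

/-- The formula `φ ∧ g₁ ∧ … ∧ g_p` (adding finitely many unit clauses). -/
def addUnits {V : Type} [DecidableEq V] (φ : CNF V) (L : Finset (Lit V)) : CNF V :=
  φ ∪ L.image (fun l => ({l} : Clause V))

/-- Variables: `n` input variables and `ℓ` auxiliary variables. -/
abbrev Var (n ℓ : ℕ) : Type := Sum (Fin n) (Fin ℓ)

/-- The literal on the `i`-th input variable with polarity `b`. -/
def inLit {n ℓ : ℕ} (i : Fin n) (b : Bool) : Lit (Var n ℓ) := (Sum.inl i, b)

/-- A p-encoding: (P1) `φ ∧ x_i` is satisfiable for each input variable `x_i`, and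
(P2) `φ ∧ x_i ⊢₁ ¬x_j` for all `i ≠ j`. -/
def IsPEncoding {n ℓ : ℕ} (φ : CNF (Var n ℓ)) : Prop :=
  IsCNF φ ∧
  (∀ i : Fin n, ∃ α : Var n ℓ → Bool, CnfSat α φ ∧ α (Sum.inl i) = true) ∧
  (∀ i j : Fin n, i ≠ j →
    UnitDerives (addUnit φ (inLit i true)) {inLit j false})

/-- A p-encoding relative to a set `I` of input indices. -/
def IsPEncodingOn {n ℓ : ℕ} (φ : CNF (Var n ℓ)) (I : Finset (Fin n)) : Prop :=
  IsCNF φ ∧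
  (∀ i ∈ I, ∃ α : Var n ℓ → Bool, CnfSat α φ ∧ α (Sum.inl i) = true) ∧
  (∀ i ∈ I, ∀ j ∈ I, i ≠ j →
    UnitDerives (addUnit φ (inLit i true)) {inLit j false})

/-- 2-CNF: every clause has at most two literals. -/
def Is2CNF {V : Type} (φ : CNF V) : Prop := ∀ C ∈ φ, C.card ≤ 2

/-- The set of possible sizes of p-encodings with `n` input variables. -/
def pencSizes (n : ℕ) : Set ℕ :=
  {k | ∃ ℓ : ℕ, ∃ φ : CNF (Var n ℓ), IsPEncoding φ ∧ φ.card = k}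

/-- `S n` : the minimum size of a p-encoding with `n` input variables. -/
noncomputable def S (n : ℕ) : ℕ := sInf (pencSizes n)

/-- The set of possible sizes of 2-CNF p-encodings with `n` input variables. -/
def penc2Sizes (n : ℕ) : Set ℕ :=
  {k | ∃ ℓ : ℕ, ∃ φ : CNF (Var n ℓ), IsPEncoding φ ∧ Is2CNF φ ∧ φ.card = k}

/-- `S₂ n` : the minimum size of a 2-CNF p-encoding with `n` input variables. -/
noncomputable def S2 (n : ℕ) : ℕ := sInf (penc2Sizes n)

/-- `φ(x,y)` is an encoding of the boolean function `f(x)`. -/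
def Encodes {n ℓ : ℕ} (φ : CNF (Var n ℓ)) (f : (Fin n → Bool) → Prop) : Prop :=
  IsCNF φ ∧
  ∀ α : Fin n → Bool, f α ↔ ∃ β : Fin ℓ → Bool, CnfSat (Sum.elim α β) φ

/-- Injection of literals on input variables into literals of the encoding. -/
def inLits {n ℓ : ℕ} (G : Finset (Lit (Fin n))) : Finset (Lit (Var n ℓ)) :=
  G.image (fun g => ((Sum.inl g.1 : Var n ℓ), g.2))

/-- Propagation complete encoding of `f`: an encoding such that whenever
`f ∧ g₁ ∧ … ∧ g_p ⊨ h` for literals on input variables (`p ≥ 1`), unit propagation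
from `φ ∧ g₁ ∧ … ∧ g_p` derives `h` or derives the empty clause. -/
def IsPCEncoding {n ℓ : ℕ} (φ : CNF (Var n ℓ)) (f : (Fin n → Bool) → Prop) : Prop :=
  Encodes φ f ∧
  ∀ G : Finset (Lit (Fin n)), G.Nonempty → ∀ h : Lit (Fin n),
    (∀ α : Fin n → Bool, f α → (∀ g ∈ G, α g.1 = g.2) → α h.1 = h.2) →
    (UnitDerives (addUnits φ (inLits G)) {((Sum.inl h.1 : Var n ℓ), h.2)} ∨
     UnitDerives (addUnits φ (inLits G)) (∅ : Clause (Var n ℓ)))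

/-- The "at most one" function. -/
def AMO (n : ℕ) (α : Fin n → Bool) : Prop :=
  (Finset.univ.filter fun i => α i = true).card ≤ 1

/-- The "exactly one" function. -/
def EXO (n : ℕ) (α : Fin n → Bool) : Prop :=
  (Finset.univ.filter fun i => α i = true).card = 1

/-- `Qset φ i` : the set of clauses of `φ` containing the literal `¬x_i`. -/
def Qset {n ℓ : ℕ} (φ : CNF (Var n ℓ)) (i : Fin n) : CNF (Var n ℓ) :=
  φ.filter (fun C => inLit i false ∈ C)

/-- Regular form: for each `i`, `|Q_i| = 2`, clauses of `Q_i` contain no input variables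
other than `x_i`, and all clauses of `Q_i` are binary. -/
def RegularForm {n ℓ : ℕ} (φ : CNF (Var n ℓ)) : Prop :=
  ∀ i : Fin n,
    (Qset φ i).card = 2 ∧
    (∀ C ∈ Qset φ i, ∀ j : Fin n, ∀ b : Bool, ((Sum.inl j : Var n ℓ), b) ∈ C → j = i) ∧
    (∀ C ∈ Qset φ i, C.card = 2)

/-- `C` is an implicate of `φ`. -/
def Implicate {V : Type} (φ : CNF V) (C : Clause V) : Prop :=
  ∀ α : V → Bool, CnfSat α φ → ClauseSat α C

/-- `C` is a prime implicate of `φ`. -/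
def PrimeImplicate {V : Type} (φ : CNF V) (C : Clause V) : Prop :=
  Implicate φ C ∧ ∀ C' : Clause V, C' ⊂ C → ¬ Implicate φ C'

/-- `φ` is prime: every clause of `φ` is a prime implicate of `φ`. -/
def IsPrime {V : Type} (φ : CNF V) : Prop := ∀ C ∈ φ, PrimeImplicate φ C

/-- The set of clauses of `φ` in which the auxiliary variable `y` occurs
(as a positive or negative literal). -/
def occursIn {n ℓ : ℕ} (φ : CNF (Var n ℓ)) (y : Fin ℓ) : CNF (Var n ℓ) :=
  φ.filter (fun C => ((Sum.inr y : Var n ℓ), true) ∈ C ∨ ((Sum.inr y : Var n ℓ), false) ∈ C)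

/-- The substitution `g₁ ← g₂` on a literal: `g₁ ↦ g₂`, `¬g₁ ↦ ¬g₂`,
all other literals unchanged. -/
def substLit {V : Type} [DecidableEq V] (g₁ g₂ : Lit V) (l : Lit V) : Lit V :=
  if l.1 = g₁.1 then (if l.2 = g₁.2 then g₂ else negLit g₂) else l

/-- The substitution `g₁ ← g₂` applied to a clause. -/
def substClause {V : Type} [DecidableEq V] (g₁ g₂ : Lit V) (C : Clause V) : Clause V :=
  C.image (substLit g₁ g₂)

/-- The formula `φ[g₁ ← g₂]`: apply the substitution to every clause and remove the
clauses that became tautological (i.e. contain a complementary pair of literals). -/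
def substCNF {V : Type} [DecidableEq V] (g₁ g₂ : Lit V) (φ : CNF V) : CNF V :=
  (φ.image (substClause g₁ g₂)).filter (fun C => IsClause C)

/-- `restrict φ ρ` : the formula `φ(ρ)` obtained from `φ` by the partial assignment
given by the set of literals `ρ` (clauses satisfied by `ρ` are removed, and falsified
literals are removed from the remaining clauses). -/
def restrict {V : Type} [DecidableEq V] (φ : CNF V) (ρ : Finset (Lit V)) : CNF V :=
  (φ.filter (fun C => ∀ l ∈ ρ, l ∉ C)).image (fun C => C.filter (fun l => negLit l ∉ ρ))

section Literals

variable {V : Type}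

theorem negLit_negLit (l : Lit V) : negLit (negLit l) = l := by
  simp [negLit]

theorem negLit_ne (l : Lit V) : negLit l ≠ l := by
  rcases l with ⟨v, b⟩
  simp [negLit]

theorem negLit_eq_iff {l m : Lit V} : negLit l = m ↔ l = negLit m := by
  constructor <;> rintro rfl <;> simp [negLit_negLit]

theorem litSat_negLit {α : V → Bool} {l : Lit V} : LitSat α (negLit l) ↔ ¬ LitSat α l := by
  simp only [LitSat, negLit]
  cases α l.1 <;> cases l.2 <;> simp

theorem eq_or_eq_negLit {l m : Lit V} (h : l.1 = m.1) : l = m ∨ l = negLit m := by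
  rcases l with ⟨v, b⟩
  rcases m with ⟨w, c⟩
  obtain rfl : v = w := h
  cases b <;> cases c <;> simp [negLit]

theorem CnfSat.mono {φ ψ : CNF V} {α : V → Bool} (h : CnfSat α φ) (hs : ψ ⊆ φ) :
    CnfSat α ψ := fun C hC => h C (hs hC)

variable [DecidableEq V]

/-- The assignment `α` modified so that the literal `l` becomes true. -/
def setLit (α : V → Bool) (l : Lit V) : V → Bool := Function.update α l.1 l.2

theorem litSat_setLit {α : V → Bool} {l m : Lit V} :
    LitSat (setLit α l) m ↔ m = l ∨ (LitSat α m ∧ m ≠ negLit l) := by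
  by_cases h : m.1 = l.1
  · rcases eq_or_eq_negLit h with rfl | rfl
    · simp [LitSat, setLit]
    · have h1 := negLit_ne l
      simp only [h1, ne_eq, not_true_eq_false, and_false, or_self, iff_false]
      simp [LitSat, setLit, negLit]
  · have h1 : m ≠ l := fun e => h (by rw [e])
    have h2 : m ≠ negLit l := fun e => h (by rw [e]; rfl)
    simp [LitSat, setLit, h, h1, h2]

theorem pair_of_mem {s : Finset (Lit V)} {v : Lit V} (hs : ∃ a b, s = {a, b}) (hv : v ∈ s) :
    ∃ c, s = {v, c} := by
  obtain ⟨a, b, rfl⟩ := hs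
  rcases Finset.mem_insert.1 hv with rfl | h
  · exact ⟨b, rfl⟩
  · rw [Finset.mem_singleton] at h
    subst h
    exact ⟨a, Finset.pair_comm _ _⟩

theorem clauseSat_pair {α : V → Bool} {u v : Lit V} :
    ClauseSat α {u, v} ↔ LitSat α u ∨ LitSat α v := by
  simp [ClauseSat]

end Literals

section Core

variable {V : Type} [DecidableEq V]

/-- The conjunction of the formula `R` with the literals in `A` has the consequence that both
`u` and `v` are true. -/
def Forces (R : CNF V) (A : Finset (Lit V)) (u v : Lit V) : Prop :=
  ∀ α, CnfSat α R → (∀ e ∈ A, LitSat α e) → LitSat α u ∧ LitSat α v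

/-- A family of terms of length two which are pairwise inconsistent modulo `R`, where moreover
`R` is irredundant and both literals of every clause of `R` are forced by two of the terms. -/
structure Core {τ : Type} (R : CNF V) (G : Finset τ) (A : τ → Finset (Lit V)) : Prop where
  pair : ∀ x ∈ G, ∃ a b, A x = {a, b}
  sat : ∀ x ∈ G, ∃ α, CnfSat α R ∧ ∀ e ∈ A x, LitSat α e
  disj : ∀ x ∈ G, ∀ y ∈ G, x ≠ y → ∀ α, CnfSat α R → (∀ e ∈ A x, LitSat α e) →
    (∀ e ∈ A y, LitSat α e) → False
  forced : ∀ u v : Lit V, {u, v} ∈ R → ∃ x ∈ G, ∃ y ∈ G, x ≠ y ∧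
    Forces R (A x) u v ∧ Forces R (A y) u v
  free : ∀ C ∈ R, ∀ u ∈ C, ∃ α, CnfSat α R ∧ ¬ LitSat α u
  vars : ∀ x ∈ G, ∀ e ∈ A x, ∃ C ∈ R, ∃ l ∈ C, l.1 = e.1
  irred : ∀ C ∈ R, ∃ α, CnfSat α (R.erase C) ∧ ¬ ClauseSat α C
  binary : ∀ C ∈ R, C.card = 2

namespace Core

variable {τ : Type} {R : CNF V} {G : Finset τ} {A : τ → Finset (Lit V)}

theorem exists_pair (h : Core R G A) {C : Clause V} (hC : C ∈ R) {u : Lit V} (hu : u ∈ C) :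
    ∃ v, v ≠ u ∧ C = {u, v} := by
  obtain ⟨a, b, hab, rfl⟩ := Finset.card_eq_two.1 (h.binary C hC)
  rcases Finset.mem_insert.1 hu with rfl | hb
  · exact ⟨b, hab.symm, rfl⟩
  · rw [Finset.mem_singleton] at hb
    subst hb
    exact ⟨a, hab, Finset.pair_comm _ _⟩

theorem not_star (h : Core R G A) {u : Lit V} (hu : ∀ C ∈ R, u ∈ C) (hR : R.Nonempty) :
    False := by
  obtain ⟨C, hC⟩ := hR
  obtain ⟨v, hvu, rfl⟩ := h.exists_pair hC (hu C hC)
  have hsat : ∀ α, LitSat α u → CnfSat α R := fun α hα C hC => ⟨u, hu C hC, hα⟩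
  obtain ⟨x, hx, y, hy, hxy, fx, fy⟩ := h.forced u v hC
  have key : ∀ x ∈ G, Forces R (A x) u v → v ∈ A x := by
    intro x hx fx
    by_contra hv
    obtain ⟨α, hα, hA⟩ := h.sat x hx
    have hf := fx α hα hA
    have h1 : LitSat (setLit α (negLit v)) u :=
      litSat_setLit.2 (Or.inr ⟨hf.1, by rw [negLit_negLit]; exact hvu.symm⟩)
    have h2 := (fx _ (hsat _ h1) (fun e he => litSat_setLit.2 (Or.inr ⟨hA e he, by
      rw [negLit_negLit]; rintro rfl; exact hv he⟩))).2
    have h3 : LitSat (setLit α (negLit v)) (negLit v) := litSat_setLit.2 (Or.inl rfl)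
    exact litSat_negLit.1 h3 h2
  obtain ⟨c, hc⟩ := pair_of_mem (h.pair x hx) (key x hx fx)
  obtain ⟨d, hd⟩ := pair_of_mem (h.pair y hy) (key y hy fy)
  obtain ⟨α, hα, hA⟩ := h.sat x hx
  obtain ⟨β, hβ, hB⟩ := h.sat y hy
  have fα := fx α hα hA
  have fβ := fy β hβ hB
  have hdβ : LitSat β d := hB d (by simp [hd])
  have hcα : LitSat α c := hA c (by simp [hc])
  have hdc : c = negLit d := by
    by_contra hcd
    have h1 : ∀ w, LitSat β w → LitSat α w → LitSat (setLit α d) w := by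
      intro w hw hw'
      refine litSat_setLit.2 (Or.inr ⟨hw', ?_⟩)
      rintro rfl
      exact litSat_negLit.1 hw hdβ
    refine h.disj x hx y hy hxy (setLit α d) (hsat _ (h1 u fβ.1 fα.1)) ?_ ?_
    · rw [hc]
      simp only [Finset.mem_insert, Finset.mem_singleton, forall_eq_or_imp, forall_eq]
      exact ⟨h1 v fβ.2 fα.2, litSat_setLit.2 (Or.inr ⟨hcα, hcd⟩)⟩
    · rw [hd]
      simp only [Finset.mem_insert, Finset.mem_singleton, forall_eq_or_imp, forall_eq]
      exact ⟨h1 v fβ.2 fα.2, litSat_setLit.2 (Or.inl rfl)⟩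
  obtain ⟨δ, hδ, hδu⟩ := h.free _ hC u (by simp)
  have hδv : LitSat δ v := (clauseSat_pair.1 (hδ _ hC)).resolve_left hδu
  by_cases hδd : LitSat δ d
  · exact hδu (fy δ hδ (by simp [hd, hδv, hδd])).1
  · exact hδu (fx δ hδ (by simp [hc, hdc, hδv, hδd, litSat_negLit])).1

theorem exists_shared (h : Core R G A) {C : Clause V} (hC : C ∈ R) :
    ∃ u ∈ C, ∃ D ∈ R, D ≠ C ∧ u ∈ D := by
  obtain ⟨u, v, huv, rfl⟩ := Finset.card_eq_two.1 (h.binary C hC)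
  by_contra hno
  push Not at hno
  obtain ⟨x, hx, y, hy, hxy, fx, fy⟩ := h.forced u v hC
  have key : ∀ w w', w ≠ w' → {w, w'} = ({u, v} : Clause V) →
      (∀ α, CnfSat α R → (∀ e ∈ A x, LitSat α e) → LitSat α w ∧ LitSat α w') → w ∈ A x := by
    intro w w' hww hC' fx
    by_contra hw
    obtain ⟨α, hα, hA⟩ := h.sat x hx
    have hf := fx α hα hA
    have hw'1 : LitSat (setLit α (negLit w)) w' :=
      litSat_setLit.2 (Or.inr ⟨hf.2, by rw [negLit_negLit]; exact hww.symm⟩)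
    have h2 := (fx (setLit α (negLit w)) ?_ (fun e he => litSat_setLit.2 (Or.inr ⟨hA e he, by
      rw [negLit_negLit]; rintro rfl; exact hw he⟩))).1
    · have h3 : LitSat (setLit α (negLit w)) (negLit w) := litSat_setLit.2 (Or.inl rfl)
      exact litSat_negLit.1 h3 h2
    · intro D hD
      by_cases hDC : D = {u, v}
      · rw [hDC, ← hC']
        exact clauseSat_pair.2 (Or.inr hw'1)
      · obtain ⟨l, hl, hlα⟩ := hα D hD
        refine ⟨l, hl, litSat_setLit.2 (Or.inr ⟨hlα, ?_⟩)⟩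
        rw [negLit_negLit]
        rintro rfl
        exact hno l (by rw [← hC']; simp) D hD hDC hl
  have hu := key u v huv rfl fx
  have hv := key v u huv.symm (Finset.pair_comm _ _) (fun α h1 h2 => (fx α h1 h2).symm)
  obtain ⟨c, hc⟩ := pair_of_mem (h.pair x hx) hu
  have hcv : v = c := by
    rw [hc] at hv
    simpa [huv.symm] using hv
  obtain ⟨β, hβ, hB⟩ := h.sat y hy
  have := fy β hβ hB
  exact h.disj x hx y hy hxy β hβ (by simp [hc, ← hcv, this]) hB

theorem not_path (h : Core R G A) {v u z w : Lit V} (hR : R = {{v, u}, {u, z}, {z, w}})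
    (hvu : v ≠ u) (huz : u ≠ z) (hvz : v ≠ z) (hwz : w ≠ z) (hwu : w ≠ u) : False := by
  have m1 : ({v, u} : Clause V) ∈ R := by simp [hR]
  have m2 : ({u, z} : Clause V) ∈ R := by simp [hR]
  have m3 : ({z, w} : Clause V) ∈ R := by simp [hR]
  have hsat : ∀ α, CnfSat α R ↔ (LitSat α v ∨ LitSat α u) ∧ (LitSat α u ∨ LitSat α z) ∧
      (LitSat α z ∨ LitSat α w) := by
    intro α
    simp [hR, CnfSat, clauseSat_pair]
  have hvz' : v ≠ negLit z := by
    rintro rfl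
    obtain ⟨α, hα, hn⟩ := h.free _ m2 u (by simp)
    rw [hsat, litSat_negLit] at hα
    tauto
  have hwu' : w ≠ negLit u := by
    rintro rfl
    obtain ⟨α, hα, hn⟩ := h.free _ m2 z (by simp)
    rw [hsat, litSat_negLit] at hα
    tauto
  have hwv' : w ≠ negLit v := by
    rintro rfl
    obtain ⟨α, hα, hn⟩ := h.irred _ m2
    have n1 : ({v, u} : Clause V) ≠ {u, z} := fun e => by
      have : v ∈ ({u, z} : Clause V) := e ▸ (by simp)
      simp [hvu, hvz] at this
    have n3 : ({z, negLit v} : Clause V) ≠ {u, z} := fun e => by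
      have : u ∈ ({z, negLit v} : Clause V) := e ▸ (by simp)
      simp [hwu.symm, huz] at this
    have a1 := hα _ (Finset.mem_erase.2 ⟨n1, m1⟩)
    have a3 := hα _ (Finset.mem_erase.2 ⟨n3, m3⟩)
    rw [clauseSat_pair] at a1 a3 hn
    rw [litSat_negLit] at a3
    tauto
  obtain ⟨x, hx, y, hy, hxy, fx, fy⟩ := h.forced u z m2
  have notboth : ∀ x ∈ G, ∀ y ∈ G, x ≠ y → Forces R (A y) u z → ¬ (u ∈ A x ∧ z ∈ A x) := by
    rintro x hx y hy hxy fy ⟨hu, hz⟩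
    obtain ⟨c, hc⟩ := pair_of_mem (h.pair x hx) hu
    have hcz : z = c := by
      rw [hc] at hz
      simpa [huz.symm] using hz
    obtain ⟨β, hβ, hB⟩ := h.sat y hy
    have := fy β hβ hB
    exact h.disj x hx y hy hxy β hβ (by simp [hc, ← hcz, this]) hB
  have key1 : ∀ x ∈ G, Forces R (A x) u z → u ∈ A x ∨ negLit v ∈ A x := by
    intro x hx fx
    by_contra hno
    push Not at hno
    obtain ⟨α, hα, hA⟩ := h.sat x hx
    have hf := fx α hα hA
    have e1 : LitSat (setLit (setLit α (negLit u)) v) v := litSat_setLit.2 (Or.inl rfl)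
    have e2 : LitSat (setLit (setLit α (negLit u)) v) z := by
      refine litSat_setLit.2 (Or.inr ⟨litSat_setLit.2 (Or.inr ⟨hf.2, ?_⟩), ?_⟩)
      · rw [negLit_negLit]; exact huz.symm
      · intro e; exact hvz' (by rw [e, negLit_negLit])
    have e3 : LitSat (setLit (setLit α (negLit u)) v) (negLit u) := by
      refine litSat_setLit.2 (Or.inr ⟨litSat_setLit.2 (Or.inl rfl), ?_⟩)
      intro e
      exact hvu (by rw [← negLit_negLit v, ← e, negLit_negLit])
    have := (fx _ ((hsat _).2 ⟨Or.inl e1, Or.inr e2, Or.inl e2⟩) (fun e he =>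
      litSat_setLit.2 (Or.inr ⟨litSat_setLit.2 (Or.inr ⟨hA e he, ?_⟩), ?_⟩))).1
    · exact litSat_negLit.1 e3 this
    · rw [negLit_negLit]; rintro rfl; exact hno.1 he
    · rintro rfl; exact hno.2 he
  have key2 : ∀ x ∈ G, Forces R (A x) u z → z ∈ A x ∨ negLit w ∈ A x := by
    intro x hx fx
    by_contra hno
    push Not at hno
    obtain ⟨α, hα, hA⟩ := h.sat x hx
    have hf := fx α hα hA
    have e1 : LitSat (setLit (setLit α (negLit z)) w) w := litSat_setLit.2 (Or.inl rfl)
    have e2 : LitSat (setLit (setLit α (negLit z)) w) u := by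
      refine litSat_setLit.2 (Or.inr ⟨litSat_setLit.2 (Or.inr ⟨hf.1, ?_⟩), ?_⟩)
      · rw [negLit_negLit]; exact huz
      · intro e; exact hwu' (by rw [e, negLit_negLit])
    have e3 : LitSat (setLit (setLit α (negLit z)) w) (negLit z) := by
      refine litSat_setLit.2 (Or.inr ⟨litSat_setLit.2 (Or.inl rfl), ?_⟩)
      intro e
      exact hwz (by rw [← negLit_negLit w, ← e, negLit_negLit])
    have := (fx _ ((hsat _).2 ⟨Or.inr e2, Or.inl e2, Or.inr e1⟩) (fun e he =>
      litSat_setLit.2 (Or.inr ⟨litSat_setLit.2 (Or.inr ⟨hA e he, ?_⟩), ?_⟩))).2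
    · exact litSat_negLit.1 e3 this
    · rw [negLit_negLit]; rintro rfl; exact hno.1 he
    · rintro rfl; exact hno.2 he
  have sub : ∀ x ∈ G, ∀ y ∈ G, x ≠ y → Forces R (A x) u z → Forces R (A y) u z →
      ∀ e ∈ A x, e = u ∨ e = z ∨ e = negLit v ∨ e = negLit w := by
    intro x hx y hy hxy fx fy e he
    obtain ⟨α, hα, hA⟩ := h.sat x hx
    have hf := fx α hα hA
    have he' := hA e he
    have k1 := key1 x hx fx
    have k2 := key2 x hx fx
    have nb := notboth x hx y hy hxy fy
    have hneg : ∀ l, l ∈ A x → negLit l ∉ A x := fun l hl hl' =>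
      litSat_negLit.1 (hA _ hl') (hA _ hl)
    have hev : e ≠ v := by
      rintro rfl
      have hu := k1.resolve_right (hneg _ he)
      have hw := k2.resolve_left (fun hz => nb ⟨hu, hz⟩)
      obtain ⟨c, hc⟩ := pair_of_mem (h.pair x hx) he
      rw [hc] at hu hw
      simp only [Finset.mem_insert, Finset.mem_singleton] at hu hw
      obtain rfl := hu.resolve_left (fun e => hvu e.symm)
      rcases hw with hw | hw
      · exact hwv' (negLit_eq_iff.1 hw)
      · exact hwu' (negLit_eq_iff.1 hw)
    have hew : e ≠ w := by
      rintro rfl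
      have hz := k2.resolve_right (hneg _ he)
      have hv := k1.resolve_left (fun hu => nb ⟨hu, hz⟩)
      obtain ⟨c, hc⟩ := pair_of_mem (h.pair x hx) he
      rw [hc] at hz hv
      simp only [Finset.mem_insert, Finset.mem_singleton] at hz hv
      obtain rfl := hz.resolve_left (fun e => hwz e.symm)
      rcases hv with hv | hv
      · exact hwv' hv.symm
      · exact hvz' (negLit_eq_iff.1 hv)
    obtain ⟨C, hC, l, hl, hle⟩ := h.vars x hx e he
    have hl' : l = u ∨ l = z ∨ l = v ∨ l = w := by
      rw [hR] at hC
      simp only [Finset.mem_insert, Finset.mem_singleton] at hC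
      rcases hC with rfl | rfl | rfl <;> simp at hl <;> tauto
    rcases hl' with rfl | rfl | rfl | rfl <;> rcases eq_or_eq_negLit hle.symm with rfl | rfl
    · simp
    · exact absurd hf.1 (litSat_negLit.1 he')
    · simp
    · exact absurd hf.2 (litSat_negLit.1 he')
    · exact absurd rfl hev
    · simp
    · exact absurd rfl hew
    · simp
  obtain ⟨α, hα, hA⟩ := h.sat x hx
  have hf := fx α hα hA
  set β := setLit (setLit α (negLit v)) (negLit w) with hβ
  have bu : LitSat β u := litSat_setLit.2 (Or.inr ⟨litSat_setLit.2 (Or.inr ⟨hf.1, by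
    rw [negLit_negLit]; exact hvu.symm⟩), by rw [negLit_negLit]; exact hwu.symm⟩)
  have bz : LitSat β z := litSat_setLit.2 (Or.inr ⟨litSat_setLit.2 (Or.inr ⟨hf.2, by
    rw [negLit_negLit]; exact hvz.symm⟩), by rw [negLit_negLit]; exact hwz.symm⟩)
  have bv : LitSat β (negLit v) := litSat_setLit.2 (Or.inr ⟨litSat_setLit.2 (Or.inl rfl), by
    rw [negLit_negLit]; exact hwv'.symm⟩)
  have bw : LitSat β (negLit w) := litSat_setLit.2 (Or.inl rfl)
  refine h.disj x hx y hy hxy β ((hsat _).2 ⟨Or.inr bu, Or.inl bu, Or.inl bz⟩) ?_ ?_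
  · intro e he
    rcases sub x hx y hy hxy fx fy e he with rfl | rfl | rfl | rfl <;> assumption
  · intro e he
    rcases sub y hy x hx hxy.symm fy fx e he with rfl | rfl | rfl | rfl <;> assumption

theorem false_of_card_le (h : Core R G A) (hR : R.Nonempty) (h3 : R.card ≤ 3) : False := by
  obtain ⟨C, hC⟩ := hR
  obtain ⟨u, hu, D, hD, hDC, huD⟩ := h.exists_shared hC
  obtain ⟨E, hE, huE⟩ : ∃ E ∈ R, u ∉ E := by
    by_contra hno
    push Not at hno
    exact h.not_star hno ⟨C, hC⟩
  have hEC : E ≠ C := fun e => huE (e ▸ hu)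
  have hED : E ≠ D := fun e => huE (e ▸ huD)
  have hR : R = {C, D, E} := by
    symm
    apply Finset.eq_of_subset_of_card_le
    · intro X hX
      simp only [Finset.mem_insert, Finset.mem_singleton] at hX
      rcases hX with rfl | rfl | rfl <;> assumption
    · rw [Finset.card_eq_three.2 ⟨C, D, E, hDC.symm, hEC.symm, hED.symm, rfl⟩]
      exact h3
  obtain ⟨v, hvu, rfl⟩ := h.exists_pair hC hu
  obtain ⟨z, hzu, rfl⟩ := h.exists_pair hD huD
  have hvz : v ≠ z := fun e => hDC (by rw [e])
  obtain ⟨s, hs, X, hX, hXE, hsX⟩ := h.exists_shared hE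
  have hsu : s ≠ u := fun e => huE (e ▸ hs)
  obtain ⟨w, hws, rfl⟩ := h.exists_pair hE hs
  have hwu : w ≠ u := fun e => huE (by simp [e])
  have hsvz : s = v ∨ s = z := by
    rw [hR] at hX
    simp only [Finset.mem_insert, Finset.mem_singleton] at hX
    rcases hX with rfl | rfl | rfl
    · simp [hsu] at hsX; exact Or.inl hsX
    · simp [hsu] at hsX; exact Or.inr hsX
    · exact absurd rfl hXE
  rcases hsvz with rfl | rfl
  · refine h.not_path (v := z) (u := u) (z := s) (w := w) ?_ hzu hvu.symm hvz.symm hws hwu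
    rw [hR, Finset.insert_comm, Finset.pair_comm u z]
  · refine h.not_path (v := v) (u := u) (z := s) (w := w) ?_ hvu hzu.symm hvz hws hwu
    rw [hR, Finset.pair_comm u v]

end Core

end Core

section Encodings

variable {V : Type} [DecidableEq V]

/-- The literals in `G` are satisfiable and pairwise inconsistent in the 2-CNF `φ`. -/
structure SemEnc (φ : CNF V) (G : Finset (Lit V)) : Prop where
  binary : Is2CNF φ
  sat : ∀ g ∈ G, ∃ α, CnfSat α φ ∧ LitSat α g
  amo : ∀ g ∈ G, ∀ h ∈ G, g ≠ h → ∀ α, CnfSat α φ → LitSat α g → ¬ LitSat α h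

/-- The clauses of `φ` containing the literal `l`. -/
def occ (φ : CNF V) (l : Lit V) : CNF V := φ.filter (fun C => l ∈ C)

theorem mem_occ {φ : CNF V} {l : Lit V} {C : Clause V} : C ∈ occ φ l ↔ C ∈ φ ∧ l ∈ C :=
  Finset.mem_filter

theorem cnfSat_of_erase {φ : CNF V} {C : Clause V} {α : V → Bool}
    (h : CnfSat α (φ.erase C)) (hC : ClauseSat α C) : CnfSat α φ := by
  intro D hD
  by_cases hDC : D = C
  · exact hDC ▸ hC
  · exact h D (Finset.mem_erase.2 ⟨hDC, hD⟩)

/-- The assignment `α` modified so that the literals in `ρ` become true. -/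
def setLits (α : V → Bool) (ρ : Finset (Lit V)) : V → Bool :=
  fun v => if (v, true) ∈ ρ then true else if (v, false) ∈ ρ then false else α v

theorem litSat_setLits {α : V → Bool} {ρ : Finset (Lit V)} (hρ : ∀ l ∈ ρ, negLit l ∉ ρ)
    {l : Lit V} : LitSat (setLits α ρ) l ↔ l ∈ ρ ∨ (LitSat α l ∧ negLit l ∉ ρ) := by
  rcases l with ⟨v, b⟩
  have h1 := hρ (v, true)
  by_cases h2 : (v, true) ∈ ρ <;> by_cases h3 : (v, false) ∈ ρ <;> cases b <;>
    simp_all [LitSat, setLits, negLit]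

theorem is2CNF_restrict {φ : CNF V} (h : Is2CNF φ) (ρ : Finset (Lit V)) :
    Is2CNF (restrict φ ρ) := by
  intro C hC
  obtain ⟨D, hD, rfl⟩ := Finset.mem_image.1 hC
  exact (Finset.card_filter_le _ _).trans (h D (Finset.mem_filter.1 hD).1)

theorem cnfSat_restrict {φ : CNF V} {ρ : Finset (Lit V)} {α : V → Bool} (h : CnfSat α φ)
    (hρ : ∀ l ∈ ρ, LitSat α l) : CnfSat α (restrict φ ρ) := by
  intro C hC
  obtain ⟨D, hD, rfl⟩ := Finset.mem_image.1 hC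
  obtain ⟨l, hl, hlα⟩ := h D (Finset.mem_filter.1 hD).1
  exact ⟨l, Finset.mem_filter.2 ⟨hl, fun h' => litSat_negLit.1 (hρ _ h') hlα⟩, hlα⟩

theorem cnfSat_setLits_of_restrict {φ : CNF V} {ρ : Finset (Lit V)} {α : V → Bool}
    (hρ : ∀ l ∈ ρ, negLit l ∉ ρ) (h : CnfSat α (restrict φ ρ)) : CnfSat (setLits α ρ) φ := by
  intro C hC
  by_cases hCρ : ∃ l ∈ ρ, l ∈ C
  · obtain ⟨l, hl, hlC⟩ := hCρ
    exact ⟨l, hlC, (litSat_setLits hρ).2 (Or.inl hl)⟩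
  · push Not at hCρ
    obtain ⟨l, hl, hlα⟩ := h _ (Finset.mem_image.2 ⟨C, Finset.mem_filter.2 ⟨hC, hCρ⟩, rfl⟩)
    rw [Finset.mem_filter] at hl
    exact ⟨l, hl.1, (litSat_setLits hρ).2 (Or.inr ⟨hlα, hl.2⟩)⟩

theorem card_restrict_add_le {φ ψ : CNF V} {ρ : Finset (Lit V)} (hψ : ψ ⊆ φ)
    (h : ∀ C ∈ ψ, ∃ l ∈ ρ, l ∈ C) : (restrict φ ρ).card + ψ.card ≤ φ.card := by
  have h1 : (restrict φ ρ).card ≤ (φ \ ψ).card := by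
    refine Finset.card_image_le.trans (Finset.card_le_card fun C hC => ?_)
    rw [Finset.mem_filter] at hC
    refine Finset.mem_sdiff.2 ⟨hC.1, fun hCψ => ?_⟩
    obtain ⟨l, hl, hlC⟩ := h C hCψ
    exact hC.2 l hl hlC
  rw [Finset.card_sdiff_of_subset hψ] at h1
  have := Finset.card_le_card hψ
  omega

theorem SemEnc.restrict {φ : CNF V} {G G' ρ : Finset (Lit V)} (h : SemEnc φ G) (hG : G' ⊆ G)
    (hv : ∀ g ∈ G', ∀ l ∈ ρ, l.1 ≠ g.1)
    (hs : ∀ g ∈ G', ∃ α, CnfSat α φ ∧ LitSat α g ∧ ∀ l ∈ ρ, LitSat α l) :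
    SemEnc (restrict φ ρ) G' where
  binary := is2CNF_restrict h.binary ρ
  sat g hg := by
    obtain ⟨α, h1, h2, h3⟩ := hs g hg
    exact ⟨α, cnfSat_restrict h1 h3, h2⟩
  amo g hg g' hg' hne α hα hgα hgα' := by
    obtain ⟨β, -, -, hβ⟩ := hs g hg
    have hρ : ∀ l ∈ ρ, negLit l ∉ ρ := fun l hl hl' => litSat_negLit.1 (hβ _ hl') (hβ _ hl)
    have key : ∀ g ∈ G', LitSat α g → LitSat (setLits α ρ) g := fun g hg hgα =>
      (litSat_setLits hρ).2 (Or.inr ⟨hgα, fun h => hv g hg _ h rfl⟩)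
    exact h.amo g (hG hg) g' (hG hg') hne _ (cnfSat_setLits_of_restrict hρ hα) (key g hg hgα)
      (key g' hg' hgα')

theorem litSat_substLit {α : V → Bool} {g₁ g₂ : Lit V} (h : LitSat α g₁ ↔ LitSat α g₂)
    (l : Lit V) : LitSat α (substLit g₁ g₂ l) ↔ LitSat α l := by
  unfold substLit
  split_ifs with h1 h2
  · rw [← h, show l = g₁ from Prod.ext h1 h2]
  · rcases eq_or_eq_negLit h1 with rfl | rfl
    · exact absurd rfl h2
    · rw [litSat_negLit, litSat_negLit, h]
  · rfl

theorem substLit_fst_ne {g₁ g₂ : Lit V} (h : g₂.1 ≠ g₁.1) (l : Lit V) :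
    (substLit g₁ g₂ l).1 ≠ g₁.1 := by
  unfold substLit
  split_ifs with h1 h2
  · exact h
  · exact h
  · exact h1

theorem cnfSat_image_substClause {α : V → Bool} {g₁ g₂ : Lit V} {φ : CNF V}
    (h : LitSat α g₁ ↔ LitSat α g₂) :
    CnfSat α (φ.image (substClause g₁ g₂)) ↔ CnfSat α φ := by
  simp only [CnfSat, Finset.forall_mem_image, ClauseSat, substClause, Finset.exists_mem_image,
    litSat_substLit h]

theorem exists_cnfSat_of_substClause {α : V → Bool} {g₁ g₂ : Lit V} {φ : CNF V}
    (hne : g₂.1 ≠ g₁.1) (hα : CnfSat α (φ.image (substClause g₁ g₂))) :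
    ∃ β, CnfSat β φ ∧ (∀ l : Lit V, l.1 ≠ g₁.1 → (LitSat β l ↔ LitSat α l)) ∧
      (LitSat β g₁ ↔ LitSat β g₂) := by
  obtain ⟨β, h1, h2⟩ : ∃ β, (∀ l : Lit V, l.1 ≠ g₁.1 → (LitSat β l ↔ LitSat α l)) ∧
      (LitSat β g₁ ↔ LitSat β g₂) := by
    by_cases hg : LitSat α g₂
    · refine ⟨setLit α g₁, fun l hl => by simp [LitSat, setLit, hl], ?_⟩
      simp [LitSat, setLit, hne] at hg ⊢
      exact hg
    · refine ⟨setLit α (negLit g₁), fun l hl => by simp [LitSat, setLit, negLit, hl], ?_⟩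
      simp [LitSat, setLit, hne, negLit] at hg ⊢
      exact hg
  refine ⟨β, (cnfSat_image_substClause h2).1 fun C hC => ?_, h1, h2⟩
  obtain ⟨l, hl, hlα⟩ := hα C hC
  refine ⟨l, hl, (h1 l ?_).2 hlα⟩
  obtain ⟨D, -, rfl⟩ := Finset.mem_image.1 hC
  obtain ⟨m, -, rfl⟩ := Finset.mem_image.1 hl
  exact substLit_fst_ne hne m

theorem is2CNF_image_substClause {φ : CNF V} (h : Is2CNF φ) (g₁ g₂ : Lit V) :
    Is2CNF (φ.image (substClause g₁ g₂)) := by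
  intro C hC
  obtain ⟨D, hD, rfl⟩ := Finset.mem_image.1 hC
  exact Finset.card_image_le.trans (h D hD)

theorem card_le_two_eq_pair {C : Clause V} (hC : C.card ≤ 2) {u v : Lit V} (hu : u ∈ C)
    (hv : v ∈ C) (huv : u ≠ v) : C = {u, v} := by
  symm
  apply Finset.eq_of_subset_of_card_le
  · intro x hx
    simp only [Finset.mem_insert, Finset.mem_singleton] at hx
    rcases hx with rfl | rfl <;> assumption
  · rwa [Finset.card_pair huv]

theorem SemEnc.exists_smaller {φ : CNF V} {G : Finset (Lit V)} (h : SemEnc φ G) {y z : Lit V}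
    (hy : y ∈ G) (hz : z ∈ G) (hzy : z ≠ y) (hv : ∀ g ∈ G, g ≠ y → g.1 ≠ y.1)
    (ho : (occ φ (negLit y)).card ≤ 1) :
    ∃ (φ' : CNF V) (G' : Finset (Lit V)), SemEnc φ' G' ∧ G'.card = G.card ∧ φ'.card < φ.card := by
  have key : ∀ g ∈ G, g ≠ y → ∀ α, CnfSat α φ → LitSat α g →
      ¬ ∀ C ∈ occ φ (negLit y), ∃ m ∈ C, m = y ∨ (LitSat α m ∧ m ≠ negLit y) := by
    intro g hg hgy α hα hgα hC
    refine h.amo y hy g hg hgy.symm (setLit α y) ?_ (litSat_setLit.2 (Or.inl rfl))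
      (litSat_setLit.2 (Or.inr ⟨hgα, fun e => hv g hg hgy (by rw [e]; rfl)⟩))
    intro C hCφ
    by_cases hyC : negLit y ∈ C
    · obtain ⟨m, hm, hm'⟩ := hC C (mem_occ.2 ⟨hCφ, hyC⟩)
      exact ⟨m, hm, litSat_setLit.2 hm'⟩
    · obtain ⟨m, hm, hm'⟩ := hα C hCφ
      exact ⟨m, hm, litSat_setLit.2 (Or.inr ⟨hm', fun e => hyC (e ▸ hm)⟩)⟩
  rcases Nat.le_one_iff_eq_zero_or_eq_one.1 ho with h0 | h1
  · obtain ⟨α, hα, hzα⟩ := h.sat z hz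
    exact absurd (by simp [Finset.card_eq_zero.1 h0]) (key z hz hzy α hα hzα)
  · obtain ⟨C, hC⟩ := Finset.card_eq_one.1 h1
    have hCo : C ∈ occ φ (negLit y) := by simp [hC]
    obtain ⟨hCφ, hyC⟩ := mem_occ.1 hCo
    rw [hC] at key
    simp only [Finset.mem_singleton, forall_eq] at key
    obtain ⟨β, hβ, hyβ⟩ := h.sat y hy
    obtain ⟨l, hl, hlβ⟩ := hβ C hCφ
    have hly : l ≠ negLit y := by
      rintro rfl
      exact litSat_negLit.1 hlβ hyβ
    have hly' : l ≠ y := by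
      rintro rfl
      obtain ⟨α, hα, hzα⟩ := h.sat z hz
      exact key z hz hzy α hα hzα ⟨l, hl, Or.inl rfl⟩
    have hlv : l.1 ≠ y.1 := fun e => (eq_or_eq_negLit e).elim hly' hly
    have hlG : l ∉ G.erase y := by
      intro hlG
      rw [Finset.mem_erase] at hlG
      exact h.amo y hy l hlG.2 hly'.symm β hβ hyβ hlβ
    refine ⟨(φ.erase C).image (substClause y l), insert l (G.erase y), ?_, ?_, ?_⟩
    · have hCeq : C = {negLit y, l} := card_le_two_eq_pair (h.binary C hCφ) hyC hl hly.symm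
      have hgl : ∀ g ∈ G.erase y, ∀ α, CnfSat α φ → LitSat α g → ¬ LitSat α l := by
        intro g hg α hα hgα hlα
        rw [Finset.mem_erase] at hg
        exact key g hg.2 hg.1 α hα hgα ⟨l, hl, Or.inr ⟨hlα, hly⟩⟩
      have model : ∀ α, CnfSat α ((φ.erase C).image (substClause y l)) →
          ∃ β, CnfSat β φ ∧ ∀ g ∈ insert l (G.erase y), LitSat β g ↔ LitSat α g := by
        intro α hα
        obtain ⟨β, hβ, h1, h2⟩ := exists_cnfSat_of_substClause hlv hα
        refine ⟨β, cnfSat_of_erase hβ ?_, ?_⟩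
        · rw [hCeq, clauseSat_pair, litSat_negLit, h2]
          tauto
        · intro g hg
          apply h1
          rcases Finset.mem_insert.1 hg with rfl | hg
          · exact hlv
          · rw [Finset.mem_erase] at hg
            exact hv g hg.2 hg.1
      refine ⟨is2CNF_image_substClause
        (fun D hD => h.binary D (Finset.mem_of_mem_erase hD)) _ _, ?_, ?_⟩
      · intro g hg
        rcases Finset.mem_insert.1 hg with rfl | hg
        · refine ⟨β, (cnfSat_image_substClause (by simp [hyβ, hlβ])).2
            (hβ.mono (Finset.erase_subset _ _)), hlβ⟩
        · obtain ⟨α, hα, hgα⟩ := h.sat g (Finset.mem_of_mem_erase hg)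
          have hlα := hgl g hg α hα hgα
          have hyα := h.amo g (Finset.mem_of_mem_erase hg) y hy (Finset.ne_of_mem_erase hg)
            α hα hgα
          exact ⟨α, (cnfSat_image_substClause (by simp [hyα, hlα])).2
            (hα.mono (Finset.erase_subset _ _)), hgα⟩
      · intro g hg g' hg' hne α hα hgα hgα'
        obtain ⟨γ, hγ, hγα⟩ := model α hα
        rw [← hγα g hg] at hgα
        rw [← hγα g' hg'] at hgα'
        rcases Finset.mem_insert.1 hg with e | hg1
        · rcases Finset.mem_insert.1 hg' with e' | hg1'
          · exact hne (e.trans e'.symm)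
          · exact hgl g' hg1' γ hγ hgα' (e ▸ hgα)
        · rcases Finset.mem_insert.1 hg' with e' | hg1'
          · exact hgl g hg1 γ hγ hgα (e' ▸ hgα')
          · exact h.amo g (Finset.mem_of_mem_erase hg1) g' (Finset.mem_of_mem_erase hg1') hne γ
              hγ hgα hgα'
    · rw [Finset.card_insert_of_notMem hlG, Finset.card_erase_of_mem hy]
      have := Finset.card_pos.2 ⟨y, hy⟩
      omega
    · exact Finset.card_image_le.trans_lt (Finset.card_erase_lt_of_mem hCφ)

end Encodings

section Critical

variable {V : Type}

/-- A counterexample of minimum size to the bound `3 * |G| ≤ |φ| + 6` for `|G| ≤ 10`. -/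
structure Critical (φ : CNF V) (G : Finset (Lit V)) : Prop where
  enc : SemEnc φ G
  le : G.card ≤ 10
  lt : φ.card + 7 ≤ 3 * G.card
  ih : ∀ (φ' : CNF V) (G' : Finset (Lit V)), φ'.card < φ.card → SemEnc φ' G' →
    G'.card ≤ 10 → 3 * G'.card ≤ φ'.card + 6

open Classical in
/-- The literals of `G` which are inconsistent with `u` modulo `φ`. -/
noncomputable def conflicts (φ : CNF V) (G : Finset (Lit V)) (u : Lit V) : Finset (Lit V) :=
  G.filter (fun x => ∀ α, CnfSat α φ → LitSat α x → ¬ LitSat α u)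

theorem mem_conflicts {φ : CNF V} {G : Finset (Lit V)} {u x : Lit V} :
    x ∈ conflicts φ G u ↔ x ∈ G ∧ ∀ α, CnfSat α φ → LitSat α x → ¬ LitSat α u := by
  classical exact Finset.mem_filter

open Classical in
/-- The literals of `G` which imply both `u` and `v` modulo `φ`. -/
noncomputable def forcing (φ : CNF V) (G : Finset (Lit V)) (u v : Lit V) : Finset (Lit V) :=
  G.filter (fun x => ∀ α, CnfSat α φ → LitSat α x → LitSat α u ∧ LitSat α v)

theorem mem_forcing {φ : CNF V} {G : Finset (Lit V)} {u v x : Lit V} :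
    x ∈ forcing φ G u v ↔
      x ∈ G ∧ ∀ α, CnfSat α φ → LitSat α x → LitSat α u ∧ LitSat α v := by
  classical exact Finset.mem_filter

theorem Critical.bound {φ : CNF V} {G : Finset (Lit V)} (h : Critical φ G) {φ' : CNF V}
    {G' : Finset (Lit V)} {k : ℕ} (hk : φ'.card + k ≤ φ.card) (h0 : 0 < k)
    (he : SemEnc φ' G') (hG : G' ⊆ G) :
    k + 1 + 3 * G'.card ≤ 3 * G.card := by
  have h1 := h.ih φ' G' (by omega) he ((Finset.card_le_card hG).trans h.le)
  have h2 := h.lt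
  omega

variable [DecidableEq V]

/-- The clauses of `φ` which contain the negation of no literal of `G`. -/
def residue (φ : CNF V) (G : Finset (Lit V)) : CNF V :=
  φ.filter (fun C => ∀ x ∈ G, negLit x ∉ C)

/-- The literals which occur in `φ` together with the negation of `x`. -/
def partners (φ : CNF V) (x : Lit V) : Finset (Lit V) :=
  ((occ φ (negLit x)).biUnion id).erase (negLit x)

namespace Critical

variable {φ : CNF V} {G : Finset (Lit V)}

theorem exists_third (h : Critical φ G) (x y : Lit V) : ∃ z ∈ G, z ≠ x ∧ z ≠ y := by
  have h1 : ({x, y} : Finset (Lit V)).card < G.card := by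
    have h2 := h.lt
    have h3 : ({x, y} : Finset (Lit V)).card ≤ 2 := Finset.card_le_two
    omega
  obtain ⟨z, hz, hz'⟩ := Finset.exists_mem_notMem_of_card_lt_card h1
  simp only [Finset.mem_insert, Finset.mem_singleton, not_or] at hz'
  exact ⟨z, hz, hz'⟩

theorem fst_ne (h : Critical φ G) {x y : Lit V} (hx : x ∈ G) (hy : y ∈ G) (hxy : x ≠ y) :
    x.1 ≠ y.1 := by
  intro e
  obtain rfl := (eq_or_eq_negLit e).resolve_left hxy
  obtain ⟨z, hz, hzx, hzy⟩ := h.exists_third (negLit y) y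
  obtain ⟨α, hα, hzα⟩ := h.enc.sat z hz
  exact h.enc.amo z hz _ hx hzx α hα hzα
    (litSat_negLit.2 (h.enc.amo z hz y hy hzy α hα hzα))

theorem negLit_notMem (h : Critical φ G) {x : Lit V} (hx : x ∈ G) : negLit x ∉ G :=
  fun hx' => h.fst_ne hx hx' (negLit_ne x).symm rfl

theorem irred (h : Critical φ G) {C : Clause V} (hC : C ∈ φ) :
    ∃ α, CnfSat α (φ.erase C) ∧ ¬ ClauseSat α C := by
  by_contra! hcon
  have hcard := Finset.card_erase_lt_of_mem hC
  have := h.bound (φ' := φ.erase C) (G' := G) (k := 1) hcard one_pos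
    ⟨fun D hD => h.enc.binary D (Finset.mem_of_mem_erase hD),
      fun g hg => (h.enc.sat g hg).imp fun α hα => ⟨hα.1.mono (Finset.erase_subset _ _), hα.2⟩,
      fun g hg g' hg' hne α hα =>
        h.enc.amo g hg g' hg' hne α (cnfSat_of_erase hα (hcon α hα))⟩ subset_rfl
  omega

theorem ne_negLit (h : Critical φ G) {u v : Lit V} (hC : {u, v} ∈ φ) : v ≠ negLit u := by
  rintro rfl
  obtain ⟨α, -, hα⟩ := h.irred hC
  rw [clauseSat_pair, litSat_negLit] at hα
  tauto

theorem semEnc_restrict (h : Critical φ G) {X U : Finset (Lit V)} (hX : X ⊆ G)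
    (hU : ∀ u ∈ U, ∀ g ∈ G \ X, u.1 ≠ g.1)
    (hs : ∀ g ∈ G \ X, ∃ α, CnfSat α φ ∧ LitSat α g ∧ ∀ u ∈ U, LitSat α u) :
    SemEnc (restrict φ (U ∪ X.image negLit)) (G \ X) := by
  refine h.enc.restrict Finset.sdiff_subset ?_ ?_
  · intro g hg l hl
    rcases Finset.mem_union.1 hl with hl | hl
    · exact hU l hl g hg
    · obtain ⟨x, hx, rfl⟩ := Finset.mem_image.1 hl
      rw [Finset.mem_sdiff] at hg
      change x.1 ≠ g.1
      exact h.fst_ne (hX hx) hg.1 (by rintro rfl; exact hg.2 hx)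
  · intro g hg
    obtain ⟨α, hα, hgα, hUα⟩ := hs g hg
    refine ⟨α, hα, hgα, fun l hl => ?_⟩
    rcases Finset.mem_union.1 hl with hl | hl
    · exact hUα l hl
    · obtain ⟨x, hx, rfl⟩ := Finset.mem_image.1 hl
      rw [Finset.mem_sdiff] at hg
      exact litSat_negLit.2 (h.enc.amo g hg.1 x (hX hx) (fun e => hg.2 (e ▸ hx)) α hα hgα)

theorem semEnc_restrict_neg (h : Critical φ G) {X : Finset (Lit V)} (hX : X ⊆ G) :
    SemEnc (restrict φ (X.image negLit)) (G \ X) := by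
  have := h.semEnc_restrict (U := ∅) hX (by simp) (fun g hg => by
    simpa using h.enc.sat g (Finset.mem_sdiff.1 hg).1)
  simpa using this

theorem card_occ_neg (h : Critical φ G) {x : Lit V} (hx : x ∈ G) :
    (occ φ (negLit x)).card = 2 := by
  apply le_antisymm
  · by_contra! hlt
    have h1 := card_restrict_add_le (φ := φ) (ψ := occ φ (negLit x))
      (ρ := ({x} : Finset (Lit V)).image negLit) (Finset.filter_subset _ _)
      (fun C hC => ⟨negLit x, by simp, (mem_occ.1 hC).2⟩)
    have hX : {x} ⊆ G := Finset.singleton_subset_iff.2 hx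
    have h2 := h.bound h1 (by omega) (h.semEnc_restrict_neg hX) Finset.sdiff_subset
    rw [Finset.card_sdiff_of_subset hX, Finset.card_singleton] at h2
    omega
  · by_contra! hlt
    obtain ⟨z, hz, hzx, -⟩ := h.exists_third x x
    obtain ⟨φ', G', he, hG', hφ'⟩ := h.enc.exists_smaller hx hz hzx
      (fun g hg hgx => h.fst_ne hg hx hgx) (by omega)
    have h1 := h.ih φ' G' hφ' he (hG' ▸ h.le)
    have h2 := h.lt
    omega

theorem card_eq_two (h : Critical φ G) {C : Clause V} (hC : C ∈ φ) : C.card = 2 := by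
  have h2 := h.enc.binary C hC
  have h3 : ∀ u, C ≠ {u} := by
    rintro u rfl
    have hu : ∀ g ∈ G, ∀ α, CnfSat α φ → LitSat α g → LitSat α u := by
      intro g hg α hα _
      simpa [ClauseSat] using hα _ hC
    have hv : ∀ g ∈ G, u.1 ≠ g.1 := by
      intro g hg e
      rcases eq_or_eq_negLit e with rfl | rfl
      · obtain ⟨z, hz, hzx, -⟩ := h.exists_third u u
        obtain ⟨α, hα, hzα⟩ := h.enc.sat z hz
        exact h.enc.amo z hz u hg hzx α hα hzα (hu z hz α hα hzα)
      · obtain ⟨α, hα, hgα⟩ := h.enc.sat g hg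
        exact litSat_negLit.1 (hu g hg α hα hgα) hgα
    have h1 := card_restrict_add_le (φ := φ) (ψ := {{u}}) (ρ := {u})
      (Finset.singleton_subset_iff.2 hC) (by simp)
    have h2 := h.bound h1 (by simp) (h.enc.restrict subset_rfl (by simpa using hv) (by
      intro g hg
      obtain ⟨α, hα, hgα⟩ := h.enc.sat g hg
      exact ⟨α, hα, hgα, by simpa using hu g hg α hα hgα⟩)) subset_rfl
    simp at h2
  have h4 : C ≠ ∅ := by
    rintro rfl
    have hlt := h.lt
    obtain ⟨z, hz⟩ := Finset.card_pos.1 (show 0 < G.card by omega)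
    obtain ⟨α, hα, -⟩ := h.enc.sat z hz
    simpa [ClauseSat] using hα _ hC
  have h5 : C.card ≠ 1 := fun h1 => by
    obtain ⟨u, hu⟩ := Finset.card_eq_one.1 h1
    exact h3 u hu
  have h6 : C.card ≠ 0 := fun h1 => h4 (Finset.card_eq_zero.1 h1)
  omega

theorem exists_pair (h : Critical φ G) {C : Clause V} (hC : C ∈ φ) {u : Lit V} (hu : u ∈ C) :
    ∃ v, v ≠ u ∧ C = {u, v} := by
  obtain ⟨a, b, hab, rfl⟩ := Finset.card_eq_two.1 (h.card_eq_two hC)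
  rcases Finset.mem_insert.1 hu with rfl | hb
  · exact ⟨b, hab.symm, rfl⟩
  · rw [Finset.mem_singleton] at hb
    subst hb
    exact ⟨a, hab, Finset.pair_comm _ _⟩

theorem pos_notMem (h : Critical φ G) {x : Lit V} (hx : x ∈ G) {C : Clause V} (hC : C ∈ φ) :
    x ∉ C := by
  intro hxC
  obtain ⟨l, hl, rfl⟩ := h.exists_pair hC hxC
  have hX : {x} ⊆ G := Finset.singleton_subset_iff.2 hx
  have hlsat : ∀ g ∈ G \ {x}, ∀ α, CnfSat α φ → LitSat α g → LitSat α l := by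
    intro g hg α hα hgα
    rw [Finset.mem_sdiff, Finset.mem_singleton] at hg
    exact (clauseSat_pair.1 (hα _ hC)).resolve_left (h.enc.amo g hg.1 x hx hg.2 α hα hgα)
  have hsat : ∀ g ∈ G \ {x}, ∃ α, CnfSat α φ ∧ LitSat α g ∧ LitSat α l := by
    intro g hg
    obtain ⟨α, hα, hgα⟩ := h.enc.sat g (Finset.mem_sdiff.1 hg).1
    exact ⟨α, hα, hgα, hlsat g hg α hα hgα⟩
  have hlv : ∀ g ∈ G \ {x}, l.1 ≠ g.1 := by
    intro g hg e
    rcases eq_or_eq_negLit e with rfl | rfl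
    · obtain ⟨z, hz, hzx, hzl⟩ := h.exists_third x l
      obtain ⟨α, hα, hzα, hlα⟩ := hsat z (by simp [hz, hzx])
      exact h.enc.amo z hz l (Finset.mem_sdiff.1 hg).1 hzl α hα hzα hlα
    · obtain ⟨α, hα, hgα, hlα⟩ := hsat g hg
      exact litSat_negLit.1 hlα hgα
  have h1 := card_restrict_add_le (φ := φ) (ψ := insert {x, l} (occ φ (negLit x)))
    (ρ := {l} ∪ ({x} : Finset (Lit V)).image negLit)
    (Finset.insert_subset hC (Finset.filter_subset _ _)) (by
      intro C hC
      rcases Finset.mem_insert.1 hC with rfl | hC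
      · exact ⟨l, by simp, by simp⟩
      · exact ⟨negLit x, by simp, (mem_occ.1 hC).2⟩)
  rw [Finset.card_insert_of_notMem, h.card_occ_neg hx] at h1
  · have h2 := h.bound h1 (by omega) (h.semEnc_restrict hX (by simpa using hlv)
      (by simpa using hsat)) Finset.sdiff_subset
    rw [Finset.card_sdiff_of_subset hX, Finset.card_singleton] at h2
    omega
  · intro hmem
    have h2 := (mem_occ.1 hmem).2
    simp only [Finset.mem_insert, Finset.mem_singleton, negLit_ne, false_or] at h2
    exact h.ne_negLit hC h2.symm

theorem neg_notMem (h : Critical φ G) {x y : Lit V} (hx : x ∈ G) (hy : y ∈ G) (hxy : x ≠ y)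
    {C : Clause V} (hC : C ∈ φ) (hxC : negLit x ∈ C) : negLit y ∉ C := by
  intro hyC
  have hX : {x} ⊆ G := Finset.singleton_subset_iff.2 hx
  have h1 := card_restrict_add_le (φ := φ) (ψ := occ φ (negLit x))
    (ρ := ({x} : Finset (Lit V)).image negLit) (Finset.filter_subset _ _)
    (fun C hC => ⟨negLit x, by simp, (mem_occ.1 hC).2⟩)
  rw [h.card_occ_neg hx] at h1
  obtain ⟨z, hz, hzx, hzy⟩ := h.exists_third x y
  obtain ⟨φ', G', he, hG', hφ'⟩ := (h.semEnc_restrict_neg hX).exists_smaller (y := y) (z := z)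
    (by simp [hy, hxy.symm]) (by simp [hz, hzx]) hzy
    (fun g hg hgy => h.fst_ne (Finset.mem_sdiff.1 hg).1 hy hgy) (by
      have h2 : occ (restrict φ (({x} : Finset (Lit V)).image negLit)) (negLit y) ⊆
          ((occ φ (negLit y)).erase C).image
            (fun C => C.filter (fun l => negLit l ∉ ({x} : Finset (Lit V)).image negLit)) := by
        intro E hE
        obtain ⟨hE, hyE⟩ := mem_occ.1 hE
        obtain ⟨D, hD, rfl⟩ := Finset.mem_image.1 hE
        rw [Finset.mem_filter] at hD
        refine Finset.mem_image_of_mem _ (Finset.mem_erase.2 ⟨?_, mem_occ.2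
          ⟨hD.1, (Finset.mem_filter.1 hyE).1⟩⟩)
        rintro rfl
        exact hD.2 (negLit x) (by simp) hxC
      have h3 := (Finset.card_le_card h2).trans Finset.card_image_le
      rwa [Finset.card_erase_of_mem (mem_occ.2 ⟨hC, hyC⟩), h.card_occ_neg hy] at h3)
  rw [Finset.card_sdiff_of_subset hX, Finset.card_singleton] at hG'
  have h2 := h.le
  have h3 := h.ih φ' G' (by omega) he (by omega)
  have h4 := h.lt
  omega

theorem card_biUnion_occ (h : Critical φ G) {L : Finset (Lit V)} (hL : L ⊆ G) :
    (L.biUnion (fun x => occ φ (negLit x))).card = 2 * L.card := by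
  rw [Finset.card_biUnion]
  · rw [Finset.sum_congr rfl (fun x hx => h.card_occ_neg (hL hx)), Finset.sum_const, smul_eq_mul,
      mul_comm]
  · intro x hx y hy hxy
    rw [Function.onFun, Finset.disjoint_left]
    intro C hCx hCy
    exact h.neg_notMem (hL hx) (hL hy) hxy (mem_occ.1 hCx).1 (mem_occ.1 hCx).2 (mem_occ.1 hCy).2

theorem card_occ_lt_card_conflicts (h : Critical φ G) {u : Lit V} (hu : ∀ g ∈ G, u.1 ≠ g.1)
    (h0 : (occ φ u).Nonempty) : (occ φ u).card < (conflicts φ G u).card := by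
  set D := conflicts φ G u with hDdef
  have hD : D ⊆ G := fun x hx => (mem_conflicts.1 hx).1
  have h1 := card_restrict_add_le (φ := φ)
    (ψ := occ φ u ∪ D.biUnion (fun x => occ φ (negLit x))) (ρ := {u} ∪ D.image negLit)
    (Finset.union_subset (Finset.filter_subset _ _)
      (Finset.biUnion_subset.2 fun x _ => Finset.filter_subset _ _)) (by
      intro C hC
      rcases Finset.mem_union.1 hC with hC | hC
      · exact ⟨u, by simp, (mem_occ.1 hC).2⟩
      · obtain ⟨x, hx, hC⟩ := Finset.mem_biUnion.1 hC
        exact ⟨negLit x, Finset.mem_union_right _ (Finset.mem_image_of_mem _ hx),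
          (mem_occ.1 hC).2⟩)
  rw [Finset.card_union_of_disjoint, h.card_biUnion_occ hD] at h1
  · have h2 := h.bound h1 (by have := h0.card_pos; omega)
      (h.semEnc_restrict hD (fun w hw g hg => by
        rw [Finset.mem_singleton.1 hw]
        exact hu g (Finset.mem_sdiff.1 hg).1) (by
        intro g hg
        rw [Finset.mem_sdiff, hDdef, mem_conflicts] at hg
        obtain ⟨hg, hg'⟩ := hg
        simp only [hg, true_and] at hg'
        push Not at hg'
        simpa using hg')) Finset.sdiff_subset
    rw [Finset.card_sdiff_of_subset hD] at h2
    have h3 := Finset.card_le_card hD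
    omega
  · rw [Finset.disjoint_left]
    intro C hCu hC
    obtain ⟨x, hx, hCx⟩ := Finset.mem_biUnion.1 hC
    obtain ⟨hxG, hx⟩ := mem_conflicts.1 hx
    have hux : u ≠ negLit x := by
      rintro rfl
      exact hu x hxG rfl
    have hCeq := card_le_two_eq_pair (h.enc.binary C (mem_occ.1 hCu).1) (mem_occ.1 hCu).2
      (mem_occ.1 hCx).2 hux
    obtain ⟨α, hα, hxα⟩ := h.enc.sat x hxG
    have h2 := hα C (mem_occ.1 hCu).1
    rw [hCeq, clauseSat_pair, litSat_negLit] at h2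
    exact h2.elim (hx α hα hxα) (fun h => h hxα)

theorem two_le_card_forcing (h : Critical φ G) {u v : Lit V} (hC : {u, v} ∈ φ)
    (hu : ∀ g ∈ G, u.1 ≠ g.1) (hv : ∀ g ∈ G, v.1 ≠ g.1) :
    2 ≤ (forcing φ G u v).card := by
  set L := forcing φ G u v with hLdef
  have hL : L ⊆ G := fun x hx => (mem_forcing.1 hx).1
  have hvu : (negLit u).1 ≠ v.1 := by
    intro e
    rcases eq_or_eq_negLit (l := v) (m := u) e.symm with rfl | rfl
    · simpa using h.card_eq_two hC
    · exact h.ne_negLit hC rfl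
  have h1 := card_restrict_add_le (φ := φ)
    (ψ := L.biUnion (fun x => occ φ (negLit x))) (ρ := L.image negLit)
    (Finset.biUnion_subset.2 fun x _ => Finset.filter_subset _ _) (by
      intro C hC
      obtain ⟨x, hx, hC⟩ := Finset.mem_biUnion.1 hC
      exact ⟨negLit x, Finset.mem_image_of_mem _ hx, (mem_occ.1 hC).2⟩)
  rw [h.card_biUnion_occ hL] at h1
  have he := h.semEnc_restrict_neg hL
  have hL1 : ∀ w : Lit V, (∀ g ∈ G, w.1 ≠ g.1) → w ∉ L.image negLit ∧
      negLit w ∉ L.image negLit := by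
    intro w hw
    constructor <;> intro hm
    · obtain ⟨x, hx, e⟩ := Finset.mem_image.1 hm
      exact hw x (hL hx) (e ▸ rfl)
    · obtain ⟨x, hx, e⟩ := Finset.mem_image.1 hm
      exact hw x (hL hx) (congrArg Prod.fst e).symm
  have hC1 : {u, v} ∈ restrict φ (L.image negLit) := by
    refine Finset.mem_image.2 ⟨{u, v}, Finset.mem_filter.2 ⟨hC, ?_⟩, ?_⟩
    · intro l hl hl'
      simp only [Finset.mem_insert, Finset.mem_singleton] at hl'
      rcases hl' with rfl | rfl
      · exact (hL1 _ hu).1 hl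
      · exact (hL1 _ hv).1 hl
    · rw [Finset.filter_eq_self]
      intro l hl
      simp only [Finset.mem_insert, Finset.mem_singleton] at hl
      rcases hl with rfl | rfl
      · exact (hL1 _ hu).2
      · exact (hL1 _ hv).2
  have h2 := Finset.card_erase_lt_of_mem hC1
  have h3 : (((restrict φ (L.image negLit)).erase {u, v}).image
      (substClause v (negLit u))).card ≤ _ := Finset.card_image_le
  have h4 := h.bound (φ' := ((restrict φ (L.image negLit)).erase {u, v}).image
    (substClause v (negLit u))) (G' := G \ L) (k := 2 * L.card + 1) (by omega) (by omega)
    ⟨is2CNF_image_substClause (fun D hD => he.binary D (Finset.mem_of_mem_erase hD)) _ _, ?_, ?_⟩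
    Finset.sdiff_subset
  · rw [Finset.card_sdiff_of_subset hL] at h4
    have h5 := Finset.card_le_card hL
    omega
  · intro g hg
    have hgL := hg
    rw [Finset.mem_sdiff, hLdef, mem_forcing] at hgL
    obtain ⟨hgG, hgL⟩ := hgL
    simp only [hgG, true_and] at hgL
    push Not at hgL
    obtain ⟨α, hα, hgα, huv⟩ := hgL
    refine ⟨α, (cnfSat_image_substClause ?_).2 ((cnfSat_restrict hα ?_).mono
      (Finset.erase_subset _ _)), hgα⟩
    · have h5 := clauseSat_pair.1 (hα _ hC)
      rw [litSat_negLit]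
      tauto
    · intro l hl
      obtain ⟨x, hx, rfl⟩ := Finset.mem_image.1 hl
      rw [Finset.mem_sdiff] at hg
      exact litSat_negLit.2 (h.enc.amo g hg.1 x (hL hx) (fun e => hg.2 (e ▸ hx)) α hα hgα)
  · intro g hg g' hg' hne α hα hgα hgα'
    obtain ⟨β, hβ, h5, h6⟩ := exists_cnfSat_of_substClause hvu hα
    refine he.amo g hg g' hg' hne β (cnfSat_of_erase hβ ?_)
      ((h5 g (hv g (Finset.mem_sdiff.1 hg).1).symm).2 hgα)
      ((h5 g' (hv g' (Finset.mem_sdiff.1 hg').1).symm).2 hgα')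
    rw [clauseSat_pair, h6, litSat_negLit]
    exact Classical.em _

theorem fst_ne_of_mem_residue (h : Critical φ G) {C : Clause V} (hC : C ∈ residue φ G)
    {l : Lit V} (hl : l ∈ C) : ∀ g ∈ G, l.1 ≠ g.1 := by
  intro g hg e
  obtain ⟨hCφ, hC⟩ := Finset.mem_filter.1 hC
  rcases eq_or_eq_negLit e with rfl | rfl
  · exact h.pos_notMem hg hCφ hl
  · exact hC g hg hl

theorem mem_partners (h : Critical φ G) {x e : Lit V} :
    e ∈ partners φ x ↔ {negLit x, e} ∈ φ := by
  simp only [partners, Finset.mem_erase, Finset.mem_biUnion, id]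
  constructor
  · rintro ⟨hne, C, hC, he⟩
    obtain ⟨hC, hx⟩ := mem_occ.1 hC
    rwa [← card_le_two_eq_pair (h.enc.binary C hC) hx he hne.symm]
  · intro hC
    refine ⟨?_, _, mem_occ.2 ⟨hC, by simp⟩, by simp⟩
    rintro rfl
    simpa using h.card_eq_two hC

theorem fst_ne_of_mem_partners (h : Critical φ G) {x e : Lit V} (hx : x ∈ G)
    (he : e ∈ partners φ x) : ∀ g ∈ G, e.1 ≠ g.1 := by
  intro g hg e1
  have hC := h.mem_partners.1 he
  rcases eq_or_eq_negLit e1 with rfl | rfl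
  · exact h.pos_notMem hg hC (by simp)
  · by_cases hxg : x = g
    · subst hxg
      simpa using h.card_eq_two hC
    · exact h.neg_notMem hx hg hxg hC (by simp) (by simp)

theorem exists_partners_eq (h : Critical φ G) {x : Lit V} (hx : x ∈ G) :
    ∃ a b, partners φ x = {a, b} := by
  obtain ⟨C, D, -, hCD⟩ := Finset.card_eq_two.1 (h.card_occ_neg hx)
  obtain ⟨hC, hxC⟩ := mem_occ.1 (show C ∈ occ φ (negLit x) by simp [hCD])
  obtain ⟨hD, hxD⟩ := mem_occ.1 (show D ∈ occ φ (negLit x) by simp [hCD])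
  obtain ⟨a, ha, rfl⟩ := h.exists_pair hC hxC
  obtain ⟨b, hb, rfl⟩ := h.exists_pair hD hxD
  refine ⟨a, b, ?_⟩
  ext e
  simp only [partners, hCD, Finset.mem_erase, Finset.mem_biUnion, Finset.mem_insert,
    Finset.mem_singleton, id, exists_eq_or_imp, exists_eq_left]
  constructor
  · tauto
  · rintro (rfl | rfl) <;> simp [ha, hb]

theorem partners_sat (h : Critical φ G) {x : Lit V} {α : V → Bool} (hα : CnfSat α φ)
    (hxα : LitSat α x) : ∀ e ∈ partners φ x, LitSat α e := by
  intro e he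
  have h1 := clauseSat_pair.1 (hα _ (h.mem_partners.1 he))
  rw [litSat_negLit] at h1
  exact h1.resolve_left (not_not.2 hxα)

theorem extend (h : Critical φ G) {X : Finset (Lit V)} (hX : X ⊆ G) {α : V → Bool}
    (hα : CnfSat α (residue φ G)) (hA : ∀ x ∈ X, ∀ e ∈ partners φ x, LitSat α e) :
    ∃ β, CnfSat β φ ∧ (∀ x ∈ X, LitSat β x) ∧
      ∀ l : Lit V, (∀ g ∈ G, l.1 ≠ g.1) → (LitSat β l ↔ LitSat α l) := by
  have hmem : ∀ l, l ∈ X ∪ (G \ X).image negLit ↔ l ∈ X ∨ (negLit l ∈ G ∧ negLit l ∉ X) := by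
    intro l
    simp only [Finset.mem_union, Finset.mem_image, Finset.mem_sdiff, negLit_eq_iff,
      exists_eq_right]
  have hρ : ∀ l ∈ X ∪ (G \ X).image negLit, negLit l ∉ X ∪ (G \ X).image negLit := by
    intro l hl hl'
    rw [hmem] at hl hl'
    rw [negLit_negLit] at hl'
    rcases hl with hl | hl <;> rcases hl' with hl' | hl'
    · exact h.negLit_notMem (hX hl) (hX hl')
    · exact hl'.2 hl
    · exact hl.2 hl'
    · exact h.negLit_notMem hl'.1 hl.1
  have hagree : ∀ l : Lit V, (∀ g ∈ G, l.1 ≠ g.1) →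
      (LitSat (setLits α (X ∪ (G \ X).image negLit)) l ↔ LitSat α l) := by
    intro l hl
    have h1 : ∀ m : Lit V, m.1 = l.1 → m ∉ X ∪ (G \ X).image negLit := by
      intro m hm hm'
      rcases (hmem m).1 hm' with h2 | h2
      · exact hl m (hX h2) hm.symm
      · exact hl _ h2.1 hm.symm
    rw [litSat_setLits hρ]
    simp [h1 l rfl, h1 (negLit l) rfl]
  refine ⟨_, ?_, fun x hx => (litSat_setLits hρ).2 (Or.inl ((hmem x).2 (Or.inl hx))), hagree⟩
  intro C hC
  by_cases hCR : C ∈ residue φ G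
  · obtain ⟨l, hl, hlα⟩ := hα C hCR
    exact ⟨l, hl, (hagree l (h.fst_ne_of_mem_residue hCR hl)).2 hlα⟩
  · have : ∃ x ∈ G, negLit x ∈ C := by
      by_contra! hcon
      exact hCR (Finset.mem_filter.2 ⟨hC, hcon⟩)
    obtain ⟨x, hx, hxC⟩ := this
    by_cases hxX : x ∈ X
    · obtain ⟨e, -, rfl⟩ := h.exists_pair hC hxC
      have he := h.mem_partners.2 hC
      exact ⟨e, by simp, (hagree e (h.fst_ne_of_mem_partners hx he)).2 (hA x hxX e he)⟩
    · exact ⟨negLit x, hxC, (litSat_setLits hρ).2 (Or.inl ((hmem _).2 (Or.inr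
        (by simp [negLit_negLit, hx, hxX]))))⟩

theorem card_conflicts_le (h : Critical φ G) {w : Lit V} (hw : ∀ g ∈ G, w.1 ≠ g.1)
    (hR : ∀ C ∈ residue φ G, ∀ l ∈ C, l.1 ≠ w.1) :
    (conflicts φ G w).card ≤ (occ φ (negLit w)).card := by
  refine Finset.card_le_card_of_injOn (fun x => {negLit x, negLit w}) ?_ ?_
  · intro x hx
    obtain ⟨hxG, hx⟩ := mem_conflicts.1 hx
    refine mem_occ.2 ⟨?_, by simp⟩
    rw [← h.mem_partners]
    by_contra hcon
    obtain ⟨α, hα, hxα⟩ := h.enc.sat x hxG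
    obtain ⟨β, hβ, hβx, hβα⟩ := h.extend (X := {x}) (α := setLit α w)
      (Finset.singleton_subset_iff.2 hxG) (by
        intro C hC
        obtain ⟨l, hl, hlα⟩ := hα C (Finset.mem_filter.1 hC).1
        refine ⟨l, hl, litSat_setLit.2 (Or.inr ⟨hlα, ?_⟩)⟩
        rintro rfl
        exact hR C hC _ hl rfl) (by
        intro y hy e he
        obtain rfl := Finset.mem_singleton.1 hy
        refine litSat_setLit.2 (Or.inr ⟨h.partners_sat hα hxα e he, ?_⟩)
        rintro rfl
        exact hcon he)
    exact hx β hβ (hβx x (by simp)) ((hβα w hw).2 (litSat_setLit.2 (Or.inl rfl)))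
  · intro x hx y hy hxy
    have hxG := (mem_conflicts.1 hx).1
    have h1 : negLit x ∈ ({negLit y, negLit w} : Finset (Lit V)) := by
      rw [← show ({negLit x, negLit w} : Finset (Lit V)) = {negLit y, negLit w} from hxy]
      simp
    simp only [Finset.mem_insert, Finset.mem_singleton, negLit_eq_iff, negLit_negLit] at h1
    rcases h1 with h1 | rfl
    · exact h1
    · exact absurd rfl (hw _ hxG)

theorem core (h : Critical φ G) : Core (residue φ G) G (partners φ) where
  pair x hx := h.exists_partners_eq hx
  sat x hx := by
    obtain ⟨α, hα, hxα⟩ := h.enc.sat x hx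
    exact ⟨α, hα.mono (Finset.filter_subset _ _), h.partners_sat hα hxα⟩
  disj x hx y hy hxy α hα hA hB := by
    obtain ⟨β, hβ, hβx, -⟩ := h.extend (X := {x, y}) (α := α)
      (Finset.insert_subset hx (Finset.singleton_subset_iff.2 hy)) hα (by
        intro z hz
        simp only [Finset.mem_insert, Finset.mem_singleton] at hz
        rcases hz with rfl | rfl <;> assumption)
    exact h.enc.amo x hx y hy hxy β hβ (hβx x (by simp)) (hβx y (by simp))
  forced u v hC := by
    have hu := h.fst_ne_of_mem_residue hC (l := u) (by simp)
    have hv := h.fst_ne_of_mem_residue hC (l := v) (by simp)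
    obtain ⟨x, hx, y, hy, hxy⟩ := Finset.one_lt_card.1
      (h.two_le_card_forcing (Finset.mem_filter.1 hC).1 hu hv)
    rw [mem_forcing] at hx hy
    have key : ∀ x ∈ G, (∀ α, CnfSat α φ → LitSat α x → LitSat α u ∧ LitSat α v) →
        Forces (residue φ G) (partners φ x) u v := by
      intro x hx hf α hα hA
      obtain ⟨β, hβ, hβx, hβα⟩ := h.extend (X := {x}) (α := α)
        (Finset.singleton_subset_iff.2 hx) hα (by simpa using hA)
      rw [← hβα u hu, ← hβα v hv]
      exact hf β hβ (hβx x (by simp))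
    exact ⟨x, hx.1, y, hy.1, hxy, key x hx.1 hx.2, key y hy.1 hy.2⟩
  free C hC u hu := by
    have hlt := h.card_occ_lt_card_conflicts (h.fst_ne_of_mem_residue hC hu)
      ⟨C, mem_occ.2 ⟨(Finset.mem_filter.1 hC).1, hu⟩⟩
    obtain ⟨x, hx⟩ := Finset.card_pos.1 (Nat.zero_lt_of_lt hlt)
    obtain ⟨hxG, hx⟩ := mem_conflicts.1 hx
    obtain ⟨α, hα, hxα⟩ := h.enc.sat x hxG
    exact ⟨α, hα.mono (Finset.filter_subset _ _), hx α hα hxα⟩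
  vars x hx e he := by
    by_contra! hR
    have hv := h.fst_ne_of_mem_partners hx he
    have h1 := h.card_conflicts_le hv hR
    have h2 := h.card_occ_lt_card_conflicts hv
      ⟨_, mem_occ.2 ⟨h.mem_partners.1 he, by simp⟩⟩
    have h3 := h.card_conflicts_le (w := negLit e) hv hR
    have h4 := h.card_occ_lt_card_conflicts (u := negLit e) hv
      (Finset.card_pos.1 (by omega))
    rw [negLit_negLit] at h3
    omega
  irred C hC := by
    obtain ⟨α, hα, hCα⟩ := h.irred (Finset.mem_filter.1 hC).1
    exact ⟨α, hα.mono (Finset.erase_subset_erase _ (Finset.filter_subset _ _)), hCα⟩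
  binary C hC := h.card_eq_two (Finset.mem_filter.1 hC).1

theorem elim (h : Critical φ G) : False := by
  have hlt := h.lt
  have hle := h.le
  obtain ⟨x, hx⟩ := Finset.card_pos.1 (show 0 < G.card by omega)
  obtain ⟨a, b, hab⟩ := h.core.pair x hx
  obtain ⟨C, hC, -⟩ := h.core.vars x hx a (by simp [hab])
  refine h.core.false_of_card_le ⟨C, hC⟩ ?_
  have h1 : φ \ residue φ G = G.biUnion (fun x => occ φ (negLit x)) := by
    ext C
    simp only [residue, Finset.mem_sdiff, Finset.mem_filter, Finset.mem_biUnion, mem_occ]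
    grind
  have h2 := Finset.card_sdiff_of_subset (show residue φ G ⊆ φ from Finset.filter_subset _ _)
  rw [h1, h.card_biUnion_occ subset_rfl] at h2
  omega

end Critical

theorem SemEnc.three_mul_card_le {φ : CNF V} {G : Finset (Lit V)} (h : SemEnc φ G)
    (hG : G.card ≤ 10) : 3 * G.card ≤ φ.card + 6 := by
  induction hn : φ.card using Nat.strong_induction_on generalizing φ G with
  | _ n ih =>
    subst hn
    by_contra! hlt
    exact Critical.elim ⟨h, hG, by omega, fun φ' G' hφ he hG' => ih _ hφ he hG' rfl⟩

end Critical

section Bounds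

variable {V : Type} [DecidableEq V]

theorem UnitDerives.clauseSat {φ : CNF V} {C : Clause V} {α : V → Bool} (h : UnitDerives φ C)
    (hα : CnfSat α φ) : ClauseSat α C := by
  induction h with
  | base hC => exact hα _ hC
  | @step l C _ _ _ ih1 ih2 =>
    obtain ⟨m, hm, hmα⟩ := ih1
    obtain rfl := Finset.mem_singleton.1 hm
    obtain ⟨l, hl, hlα⟩ := ih2
    refine ⟨l, Finset.mem_erase.2 ⟨?_, hl⟩, hlα⟩
    rintro rfl
    exact litSat_negLit.1 hlα hmα

theorem IsPEncoding.semEnc {n ℓ : ℕ} {φ : CNF (Var n ℓ)} (h : IsPEncoding φ) (h2 : Is2CNF φ) :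
    SemEnc φ (Finset.univ.image (fun i => inLit i true)) where
  binary := h2
  sat g hg := by
    obtain ⟨i, -, rfl⟩ := Finset.mem_image.1 hg
    exact h.2.1 i
  amo g hg g' hg' hne α hα hgα := by
    obtain ⟨i, -, rfl⟩ := Finset.mem_image.1 hg
    obtain ⟨j, -, rfl⟩ := Finset.mem_image.1 hg'
    have hij : i ≠ j := fun e => hne (by rw [e])
    obtain ⟨l, hl, hlα⟩ := (h.2.2 i j hij).clauseSat (α := α) (by
      intro C hC
      rcases Finset.mem_insert.1 hC with rfl | hC
      · exact ⟨_, Finset.mem_singleton_self _, hgα⟩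
      · exact hα C hC)
    obtain rfl := Finset.mem_singleton.1 hl
    exact (litSat_negLit (l := inLit j true)).1 hlα

theorem three_mul_le_of_mem_penc2Sizes {n k : ℕ} (hn : n ≤ 10) (hk : k ∈ penc2Sizes n) :
    3 * n ≤ k + 6 := by
  obtain ⟨ℓ, φ, h, h2, rfl⟩ := hk
  have hcard : (Finset.univ.image (fun i : Fin n => (inLit i true : Lit (Var n ℓ)))).card = n := by
    rw [Finset.card_image_of_injective, Finset.card_univ, Fintype.card_fin]
    intro i j hij
    simpa [inLit] using hij
  have := (h.semEnc h2).three_mul_card_le (by omega)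
  omega

theorem isClause_pair {a b : Lit V} (h : a.1 ≠ b.1) : IsClause {a, b} := by
  intro l hl hl'
  simp only [Finset.mem_insert, Finset.mem_singleton] at hl hl'
  rcases hl with rfl | rfl <;> rcases hl' with h1 | h1
  · exact negLit_ne _ h1
  · exact h (congrArg Prod.fst h1 :)
  · exact h (congrArg Prod.fst h1 :).symm
  · exact negLit_ne _ h1

/-- The clause `l → m` belongs to `φ`. -/
def ImpClause (φ : CNF V) (l m : Lit V) : Prop := {negLit l, m} ∈ φ

theorem ImpClause.contrapose {φ : CNF V} {l m : Lit V} (h : ImpClause φ l m) :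
    ImpClause φ (negLit m) (negLit l) := by
  rw [ImpClause, negLit_negLit, Finset.pair_comm]
  exact h

theorem reflTransGen_contrapose {φ : CNF V} {l m : Lit V}
    (h : Relation.ReflTransGen (ImpClause φ) l m) :
    Relation.ReflTransGen (ImpClause φ) (negLit m) (negLit l) := by
  induction h with
  | refl => exact .refl
  | tail _ hm ih => exact .head hm.contrapose ih

theorem unitDerives_of_reflTransGen {φ : CNF V} {l m : Lit V}
    (h : Relation.ReflTransGen (ImpClause φ) l m) : UnitDerives (addUnit φ l) {m} := by
  induction h with
  | refl => exact .base (Finset.mem_insert_self _ _)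
  | @tail b c _ hm ih =>
    by_cases hbc : negLit b = c
    · rw [ImpClause, hbc, Finset.pair_eq_singleton] at hm
      exact .base (Finset.mem_insert_of_mem hm)
    · have h1 := UnitDerives.step ih (.base (Finset.mem_insert_of_mem hm)) (by simp)
      rwa [Finset.erase_insert (by simpa using hbc)] at h1

end Bounds

section Ladder

/-- The literals expressing that one of the first `t + 1` input variables is true. -/
def ladderLit (m : ℕ) (t : Fin (m + 1)) : Lit (Var (m + 3) m) :=
  Fin.cases (inLit 0 true) (fun k => (Sum.inr k, true)) t

/-- The input literals of the ladder encoding which are not among the last two. -/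
def rungLit (m : ℕ) (k : Fin m) : Lit (Var (m + 3) m) := inLit ⟨k + 1, by omega⟩ true

/-- The sequential encoding of the constraint that at most one of `m + 3` variables is true. -/
def ladder (m : ℕ) : CNF (Var (m + 3) m) :=
  Finset.univ.biUnion (fun k : Fin m =>
    {{negLit (ladderLit m k.castSucc), ladderLit m k.succ},
      {negLit (rungLit m k), ladderLit m k.succ},
      {negLit (ladderLit m k.castSucc), negLit (rungLit m k)}}) ∪
  {{negLit (ladderLit m (Fin.last m)), inLit ⟨m + 1, by omega⟩ false},
    {negLit (ladderLit m (Fin.last m)), inLit ⟨m + 2, by omega⟩ false},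
    {inLit ⟨m + 1, by omega⟩ false, inLit ⟨m + 2, by omega⟩ false}}

theorem forall_mem_ladder {m : ℕ} {P : Clause (Var (m + 3) m) → Prop} :
    (∀ C ∈ ladder m, P C) ↔
      (∀ k : Fin m, P {negLit (ladderLit m k.castSucc), ladderLit m k.succ} ∧
        P {negLit (rungLit m k), ladderLit m k.succ} ∧
        P {negLit (ladderLit m k.castSucc), negLit (rungLit m k)}) ∧
      P {negLit (ladderLit m (Fin.last m)), inLit ⟨m + 1, by omega⟩ false} ∧
      P {negLit (ladderLit m (Fin.last m)), inLit ⟨m + 2, by omega⟩ false} ∧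
      P {inLit ⟨m + 1, by omega⟩ false, inLit ⟨m + 2, by omega⟩ false} := by
  simp only [ladder, Finset.forall_mem_union, Finset.mem_biUnion, Finset.mem_univ, true_and,
    Finset.forall_mem_insert, forall_exists_index, Finset.mem_singleton, forall_eq]
  rw [forall_comm]
  simp only [Finset.forall_mem_insert, Finset.mem_singleton, forall_eq]

theorem card_ladder_le (m : ℕ) : (ladder m).card ≤ 3 * m + 3 := by
  refine (Finset.card_union_le _ _).trans (add_le_add ?_ Finset.card_le_three)
  refine (Finset.card_biUnion_le_card_mul _ _ 3 fun _ _ => Finset.card_le_three).trans ?_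
  simp [mul_comm]

theorem ladderLit_fst_ne_inl {m : ℕ} {t : Fin (m + 1)} {i : Fin (m + 3)} (hi : i ≠ 0) :
    (ladderLit m t).1 ≠ Sum.inl i := by
  cases t using Fin.cases with
  | zero => simpa [ladderLit, inLit] using hi.symm
  | succ k => simp [ladderLit]

theorem ladderLit_fst_ne_inr {m : ℕ} {t : Fin (m + 1)} {k : Fin m} (hk : t ≠ k.succ) :
    (ladderLit m t).1 ≠ Sum.inr k := by
  cases t using Fin.cases with
  | zero => simp [ladderLit, inLit]
  | succ j => simpa [ladderLit] using hk

theorem isCNF_ladder (m : ℕ) : IsCNF (ladder m) := by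
  refine forall_mem_ladder.2 ⟨fun k => ⟨?_, ?_, ?_⟩, ?_, ?_, ?_⟩
  · exact isClause_pair (ladderLit_fst_ne_inr (Fin.castSucc_lt_succ).ne)
  · exact isClause_pair (fun e => ladderLit_fst_ne_inl (Fin.ne_of_val_ne (by simp)) e.symm)
  · exact isClause_pair (ladderLit_fst_ne_inl (Fin.ne_of_val_ne (by simp)))
  · exact isClause_pair (ladderLit_fst_ne_inl (Fin.ne_of_val_ne (by simp)))
  · exact isClause_pair (ladderLit_fst_ne_inl (Fin.ne_of_val_ne (by simp)))
  · exact isClause_pair (by simp [inLit])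

theorem is2CNF_ladder (m : ℕ) : Is2CNF (ladder m) :=
  forall_mem_ladder.2 ⟨fun _ => ⟨Finset.card_le_two, Finset.card_le_two, Finset.card_le_two⟩,
    Finset.card_le_two, Finset.card_le_two, Finset.card_le_two⟩

theorem ladder_sat {m : ℕ} (i : Fin (m + 3)) :
    ∃ α, CnfSat α (ladder m) ∧ α (Sum.inl i) = true := by
  refine ⟨Sum.elim (fun j => decide (j = i)) (fun k : Fin m => decide (i.1 ≤ k + 1)), ?_,
    by simp⟩
  set α : Var (m + 3) m → Bool :=
    Sum.elim (fun j => decide (j = i)) (fun k : Fin m => decide (i.1 ≤ k + 1)) with hα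
  have hx : ∀ j, LitSat α (inLit j true) ↔ j = i := by simp [inLit, LitSat, hα]
  have hL : ∀ t, LitSat α (ladderLit m t) ↔ i.1 ≤ t := by
    intro t
    cases t using Fin.cases with
    | zero =>
      refine (hx 0).trans ?_
      rw [Fin.ext_iff, Fin.val_zero, Fin.val_zero]
      omega
    | succ k => simp [ladderLit, LitSat, hα]
  have hx' : ∀ j, LitSat α (inLit j false) ↔ j ≠ i := by simp [inLit, LitSat, hα]
  refine forall_mem_ladder.2 ⟨fun k => ⟨?_, ?_, ?_⟩, ?_, ?_, ?_⟩ <;>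
    simp only [clauseSat_pair, litSat_negLit, hL, hx, hx', rungLit, Fin.ext_iff, Fin.val_castSucc,
      Fin.val_succ, Fin.val_last, ne_eq] <;> omega

theorem ladder_reach_ladderLit {m : ℕ} (t : Fin (m + 1)) (i : Fin (m + 3)) (hi : i.1 ≤ t) :
    Relation.ReflTransGen (ImpClause (ladder m)) (inLit i true) (ladderLit m t) := by
  have hmem := forall_mem_ladder.1 (fun C (hC : C ∈ ladder m) => hC)
  induction t using Fin.induction with
  | zero =>
    obtain rfl : i = 0 := Fin.ext (by simpa using hi)
    exact .refl
  | succ k ih =>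
    rcases Nat.lt_or_eq_of_le hi with h | h
    · exact (ih (Nat.lt_succ_iff.1 h)).tail (hmem.1 k).1
    · rw [show i = ⟨k + 1, by omega⟩ from Fin.ext h]
      exact .single (hmem.1 k).2.1

theorem ladder_reach_of_lt {m : ℕ} {i j : Fin (m + 3)} (hij : i < j) :
    Relation.ReflTransGen (ImpClause (ladder m)) (inLit i true) (inLit j false) := by
  have hmem := forall_mem_ladder.1 (fun C (hC : C ∈ ladder m) => hC)
  have hij' : i.1 < j.1 := hij
  by_cases hj : j.1 ≤ m
  · obtain ⟨k, hk⟩ : ∃ k : Fin m, j.1 = k + 1 := ⟨⟨j - 1, by omega⟩, by simp; omega⟩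
    rw [show j = ⟨k + 1, by omega⟩ from Fin.ext hk]
    exact (ladder_reach_ladderLit k.castSucc i (by simp; omega)).tail (hmem.1 k).2.2
  · have hj' : j = ⟨m + 1, by omega⟩ ∨ j = ⟨m + 2, by omega⟩ := by
      simp only [Fin.ext_iff]
      omega
    by_cases hi : i.1 ≤ m
    · refine (ladder_reach_ladderLit (Fin.last m) i hi).tail ?_
      rcases hj' with h | h <;> rw [h]
      · exact hmem.2.1
      · exact hmem.2.2.1
    · have hj'' : j.1 = m + 2 := by omega
      rw [show i = ⟨m + 1, by omega⟩ from Fin.ext (by simp; omega),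
        show j = ⟨m + 2, by omega⟩ from Fin.ext hj'']
      exact .single hmem.2.2.2

theorem isPEncoding_ladder (m : ℕ) : IsPEncoding (ladder m) := by
  refine ⟨isCNF_ladder m, ladder_sat, fun i j hij => ?_⟩
  apply unitDerives_of_reflTransGen
  rcases lt_or_gt_of_ne hij with h | h
  · exact ladder_reach_of_lt h
  · exact reflTransGen_contrapose (ladder_reach_of_lt h)

end Ladder

/-- For every n with 3 ≤ n ≤ 10, the minimum size S₂(n) of a 2-CNF
p-encoding with n input variables equals 3n − 6. -/
theorem penc2_min_size_small (n : ℕ) (h3 : 3 ≤ n) (h10 : n ≤ 10) :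
    S2 n = 3 * n - 6 := by
  obtain ⟨m, rfl⟩ := Nat.exists_eq_add_of_le' h3
  have hmem : (ladder m).card ∈ penc2Sizes (m + 3) :=
    ⟨m, ladder m, isPEncoding_ladder m, is2CNF_ladder m, rfl⟩
  apply le_antisymm
  · have h1 := (Nat.sInf_le hmem).trans (card_ladder_le m)
    rw [S2]
    omega
  · refine le_csInf ⟨_, hmem⟩ fun k hk => ?_
    have := three_mul_le_of_mem_penc2Sizes h10 hk
    omega
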